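/- Composition in the category STR is associative: let (H, α) : (L, M) → (L', N'), (H', α') : (L', N') → (L'', N''), and (H'', α'') : (L'', N'') → (L''', N''') be morphisms of STR. Then ((H'', α'') ∗ (H', α')) ∗ (H, α) = (H'', α'') ∗ ((H', α') ∗ (H, α)), where ∗ denotes the composition (H', α') ∗ (H, α) := (H' ∘ H, α ∘ E(H)(α')). -/

import Mathlib

open FirstOrder Language

/-- A language morphism datum: sends each `n`-ary function symbol of `L` to an `L'`-term
with variables among `x_0, …, x_{n-1}`, and each `n`-ary relation symbol of `L` to an
`L'`-formula with free variables among `x_0, …, x_{n-1}`. -/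
structure LangMorphism (L : Language) (L' : Language) where
  onFun : ∀ {n : ℕ}, L.Functions n → L'.Term (Fin n)
  onRel : ∀ {n : ℕ}, L.Relations n → L'.Formula (Fin n)

namespace LangMorphism

variable {L L' L'' L''' : Language}

/-- The extension `H` of a language morphism datum to all terms. -/
def onTerm (H : LangMorphism L L') {α : Type*} : L.Term α → L'.Term α
  | .var i => .var i
  | .func f ts => (H.onFun f).subst fun i => H.onTerm (ts i)

/-- The extension `H` of a language morphism datum to all (bounded) formulas. -/
def onBoundedFormula (H : LangMorphism L L') {α : Type*} :
    ∀ {n : ℕ}, L.BoundedFormula α n → L'.BoundedFormula α n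
  | _, .falsum => .falsum
  | _, .equal t s => .equal (H.onTerm t) (H.onTerm s)
  | _, .rel R ts => ((H.onRel R).subst fun i => H.onTerm (ts i)).relabel id
  | _, .imp φ ψ => .imp (H.onBoundedFormula φ) (H.onBoundedFormula ψ)
  | _, .all φ => .all (H.onBoundedFormula φ)

/-- The extension `H` of a language morphism datum to all formulas. -/
def onFormula (H : LangMorphism L L') {α : Type*} (φ : L.Formula α) : L'.Formula α :=
  H.onBoundedFormula φ

/-- The induced structure `E(H)(M')`: same underlying set, function symbols interpreted by
realizing the corresponding terms, relation symbols by the sets defined by the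
corresponding formulas. -/
def inducedStructure (H : LangMorphism L L') (M : Type*) [L'.Structure M] :
    L.Structure M where
  funMap f x := (H.onFun f).realize x
  RelMap R x := (H.onRel R).Realize x

/-- The identity language morphism datum. -/
def idDatum (L : Language) : LangMorphism L L where
  onFun f := Term.func f Term.var
  onRel R := R.formula Term.var

/-- Composition of language morphism data. -/
def comp (H' : LangMorphism L' L'') (H : LangMorphism L L') : LangMorphism L L'' where
  onFun f := H'.onTerm (H.onFun f)
  onRel R := H'.onFormula (H.onRel R)

end LangMorphism

/-- `α` is a homomorphism of `L`-structures: it commutes with the interpretations of all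
function symbols and preserves (forward) the interpretations of all relation symbols. -/
def IsHom (L : Language) {M N : Type*} [L.Structure M] [L.Structure N] (α : M → N) : Prop :=
  (∀ (n : ℕ) (f : L.Functions n) (x : Fin n → M),
      α (Structure.funMap f x) = Structure.funMap f (α ∘ x)) ∧
    ∀ (n : ℕ) (R : L.Relations n) (x : Fin n → M),
      Structure.RelMap R x → Structure.RelMap R (α ∘ x)

namespace FirstOrder.Language

variable {L : Language} {α β γ : Type*}

namespace Term

theorem subst_subst (t : L.Term α) (σ : α → L.Term β) (τ : β → L.Term γ) :
    (t.subst σ).subst τ = t.subst fun a => (σ a).subst τ := by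
  induction t with
  | var => rfl
  | func f ts ih => simp [subst, ih]

theorem relabel_eq_subst (t : L.Term α) (g : α → β) :
    t.relabel g = t.subst fun a => var (g a) := by
  induction t with
  | var => rfl
  | func f ts ih => simp [subst, ih]

end Term

namespace BoundedFormula

/-- Extends a substitution with values in terms over `n` bound variables to variables including
`k` further bound variables, which are placed above the first `n`. -/
def liftSubst {n k m : ℕ} (σ : α → L.Term (β ⊕ Fin n)) (h : n + k = m) :
    α ⊕ Fin k → L.Term (β ⊕ Fin m) :=
  Sum.elim
    (fun a => (σ a).relabel (Sum.map id (Fin.castLE (h ▸ Nat.le_add_right n k))))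
    (fun j => Term.var (Sum.inr (Fin.cast h (Fin.natAdd n j))))

/-- Substitutes the free variables of a bounded formula with terms over `n` bound variables,
shifting the existing bound variables above these. -/
def substBound {n : ℕ} (σ : α → L.Term (β ⊕ Fin n)) :
    ∀ {k m : ℕ}, L.BoundedFormula α k → n + k = m → L.BoundedFormula β m
  | _, _, falsum, _ => falsum
  | _, _, equal t s, h => equal (t.subst (liftSubst σ h)) (s.subst (liftSubst σ h))
  | _, _, rel R ts, h => rel R fun i => (ts i).subst (liftSubst σ h)
  | _, _, imp φ ψ, h => imp (φ.substBound σ h) (ψ.substBound σ h)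
  | _, _, all φ, h => all (φ.substBound σ (congrArg (· + 1) h))

theorem relabel_relabelAux_subst {n k : ℕ} (σ : α → L.Term (β ⊕ Fin n))
    (t : L.Term (α ⊕ Fin k)) :
    (t.subst (Sum.elim (Term.relabel Sum.inl ∘ σ) (Term.var ∘ Sum.inr))).relabel
      (relabelAux id k) = t.subst (liftSubst σ rfl) := by
  rw [Term.relabel_eq_subst, Term.subst_subst]
  congr 1
  funext x
  rcases x with a | j
  · simp only [Sum.elim_inl, Function.comp_apply, liftSubst, ← Term.relabel_eq_subst,
      Term.relabel_relabel]
    congr 1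
    funext y
    rcases y with b | i <;> rfl
  · simp [liftSubst, relabelAux, Term.subst]

theorem relabel_id_subst {n k : ℕ} (σ : α → L.Term (β ⊕ Fin n)) (φ : L.BoundedFormula α k) :
    (φ.subst σ).relabel id = φ.substBound σ rfl := by
  induction φ with
  | falsum => rfl
  | equal t s =>
    exact congrArg₂ equal (relabel_relabelAux_subst σ t) (relabel_relabelAux_subst σ s)
  | rel R ts => exact congrArg (rel R) (funext fun i => relabel_relabelAux_subst σ (ts i))
  | imp φ ψ ihφ ihψ => exact congrArg₂ imp ihφ ihψ
  | all φ ih => exact (relabel_all id (φ.subst σ)).trans (congrArg all ih)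

theorem subst_liftSubst_liftSubst {n k j l m p : ℕ} (σ : α → L.Term (β ⊕ Fin n))
    (τ : γ → L.Term (α ⊕ Fin k)) (t : L.Term (γ ⊕ Fin j)) (h₁ : k + j = l) (h₂ : n + l = m)
    (h₃ : n + k = p) (h₄ : p + j = m) :
    (t.subst (liftSubst τ h₁)).subst (liftSubst σ h₂) =
      t.subst (liftSubst (fun c => (τ c).subst (liftSubst σ h₃)) h₄) := by
  rw [Term.subst_subst]
  congr 1
  funext x
  rcases x with c | i
  · simp only [liftSubst, Sum.elim_inl, Term.relabel_eq_subst, Term.subst_subst]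
    congr 1
    funext y
    rcases y with a | i
    · simp only [Term.subst, Sum.map_inl, Sum.elim_inl, id, Term.subst_subst]
      congr 1
      funext z
      rcases z with b | i <;> rfl
    · rfl
  · simp only [liftSubst, Sum.elim_inr, Term.subst, Term.var.injEq, Sum.inr.injEq, Fin.ext_iff,
      Fin.val_cast, Fin.val_natAdd]
    omega

theorem substBound_substBound {n k j l m p : ℕ} (σ : α → L.Term (β ⊕ Fin n))
    (τ : γ → L.Term (α ⊕ Fin k)) (φ : L.BoundedFormula γ j) (h₁ : k + j = l) (h₂ : n + l = m)
    (h₃ : n + k = p) (h₄ : p + j = m) :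
    (φ.substBound τ h₁).substBound σ h₂ =
      φ.substBound (fun c => (τ c).subst (liftSubst σ h₃)) h₄ := by
  induction φ generalizing l m with
  | falsum => rfl
  | equal t s => simp only [substBound, subst_liftSubst_liftSubst σ τ _ h₁ h₂ h₃ h₄]
  | rel R ts => simp only [substBound, subst_liftSubst_liftSubst σ τ _ h₁ h₂ h₃ h₄]
  | imp φ ψ ihφ ihψ => exact congrArg₂ imp (ihφ h₁ h₂ h₄) (ihψ h₁ h₂ h₄)
  | all φ ih => exact congrArg all (ih _ _ _)

end BoundedFormula

end FirstOrder.Language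

namespace LangMorphism

open BoundedFormula

variable {L L' L'' L''' : Language} {α β : Type*}

theorem onTerm_subst (H : LangMorphism L L') (t : L.Term α) (σ : α → L.Term β) :
    H.onTerm (t.subst σ) = (H.onTerm t).subst fun a => H.onTerm (σ a) := by
  induction t with
  | var => rfl
  | func f ts ih => simp only [Term.subst, onTerm, ih, Term.subst_subst]

theorem onTerm_relabel (H : LangMorphism L L') (t : L.Term α) (g : α → β) :
    H.onTerm (t.relabel g) = (H.onTerm t).relabel g := by
  simp only [Term.relabel_eq_subst, onTerm_subst, onTerm]

theorem onTerm_comp (H' : LangMorphism L' L'') (H : LangMorphism L L') (t : L.Term α) :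
    (H'.comp H).onTerm t = H'.onTerm (H.onTerm t) := by
  induction t with
  | var => rfl
  | func f ts ih =>
    simp only [onTerm, ih, onTerm_subst]
    rfl

theorem onTerm_liftSubst (H : LangMorphism L L') {n k m : ℕ} (σ : α → L.Term (β ⊕ Fin n))
    (h : n + k = m) (x : α ⊕ Fin k) :
    H.onTerm (liftSubst σ h x) = liftSubst (fun a => H.onTerm (σ a)) h x := by
  rcases x with a | j
  · exact H.onTerm_relabel _ _
  · rfl

theorem onBoundedFormula_rel (H : LangMorphism L L') {n l : ℕ} (R : L.Relations l)
    (ts : Fin l → L.Term (α ⊕ Fin n)) :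
    H.onBoundedFormula (.rel R ts) =
      substBound (fun i => H.onTerm (ts i)) (H.onRel R) (Nat.add_zero n) :=
  relabel_id_subst _ _

theorem onBoundedFormula_substBound (H : LangMorphism L L') {n k m : ℕ}
    (σ : α → L.Term (β ⊕ Fin n)) (φ : L.BoundedFormula α k) (h : n + k = m) :
    H.onBoundedFormula (φ.substBound σ h) =
      (H.onBoundedFormula φ).substBound (fun a => H.onTerm (σ a)) h := by
  induction φ generalizing m with
  | falsum => rfl
  | equal t s => simp only [substBound, onBoundedFormula, onTerm_subst, onTerm_liftSubst]
  | rel R ts =>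
    rw [onBoundedFormula_rel, substBound_substBound _ _ _ _ _ h (Nat.add_zero m), substBound,
      onBoundedFormula_rel]
    simp only [onTerm_subst, onTerm_liftSubst]
  | imp φ ψ ihφ ihψ => exact congrArg₂ BoundedFormula.imp (ihφ h) (ihψ h)
  | all φ ih => exact congrArg BoundedFormula.all (ih _)

theorem onBoundedFormula_comp (H' : LangMorphism L' L'') (H : LangMorphism L L') {n : ℕ}
    (φ : L.BoundedFormula α n) :
    (H'.comp H).onBoundedFormula φ = H'.onBoundedFormula (H.onBoundedFormula φ) := by
  induction φ with
  | falsum => rfl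
  | equal t s => simp only [onBoundedFormula, onTerm_comp]
  | rel R ts =>
    simp only [onBoundedFormula_rel, onBoundedFormula_substBound, onTerm_comp]
    rfl
  | imp φ ψ ihφ ihψ => exact congrArg₂ BoundedFormula.imp ihφ ihψ
  | all φ ih => exact congrArg BoundedFormula.all ih

theorem comp_assoc (H'' : LangMorphism L'' L''') (H' : LangMorphism L' L'')
    (H : LangMorphism L L') : (H''.comp H').comp H = H''.comp (H'.comp H) := by
  refine LangMorphism.mk.injEq _ _ _ _ |>.mpr ⟨?_, ?_⟩
  · funext n f
    exact onTerm_comp H'' H' (H.onFun f)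
  · funext n R
    exact onBoundedFormula_comp H'' H' (H.onRel R)

end LangMorphism

/-- composition in the category `STR` is associative.  A morphism
`(H, α) : (L, M) → (L', N')` consists of a language morphism datum `H : L → L'` and a
homomorphism `α : E(H)(N') → M`; composition is `(H', α') ∗ (H, α) := (H' ∘ H, α ∘ E(H)(α'))`,
whose components are the composite datum and the composite map `α ∘ α'`.  Equality of
morphisms of `STR` is componentwise, so associativity says both components agree. -/
theorem STR_comp_assoc {L L' L'' L''' : Language}
    (M N' N'' N''' : Type*)
    [iM : L.Structure M] [iN' : L'.Structure N'] [iN'' : L''.Structure N'']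
    [iN''' : L'''.Structure N''']
    (H : LangMorphism L L') (H' : LangMorphism L' L'') (H'' : LangMorphism L'' L''')
    (α : N' → M) (α' : N'' → N') (α'' : N''' → N'')
    (hα : @IsHom L N' M (H.inducedStructure N') iM α)
    (hα' : @IsHom L' N'' N' (H'.inducedStructure N'') iN' α')
    (hα'' : @IsHom L'' N''' N'' (H''.inducedStructure N''') iN'' α'') :
    (H''.comp H').comp H = H''.comp (H'.comp H) ∧
      α ∘ (α' ∘ α'') = (α ∘ α') ∘ α'' :=
  ⟨LangMorphism.comp_assoc H'' H' H, rfl⟩
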